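/- Let ε = 10^{-30}, α = 20√ε, and λ = 300√α. There exist a constant c > 0 and an integer k_0 such that for every odd integer k ≥ k_0, every red/blue two-coloring of the edges of the complete graph on n = 2k − 1 vertices that is an extremal coloring with parameter λ contains at least (ck)^k monochromatic cycles of length k. -/

import Mathlib

open Finset
open scoped Classical

noncomputable section

/-- Number of ordered pairs `(x, y) ∈ X × Y` that are adjacent in `G`. -/
def interPairs {V : Type*} (G : SimpleGraph V) (X Y : Finset V) : ℕ :=
  ((X ×ˢ Y).filter fun p => G.Adj p.1 p.2).card

/-- The edge density `d(X, Y) = e(X, Y) / (|X| |Y|)` between disjoint sets `X` and `Y`. -/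
def dens {V : Type*} (G : SimpleGraph V) (X Y : Finset V) : ℝ :=
  (interPairs G X Y : ℝ) / ((X.card : ℝ) * (Y.card : ℝ))

/-- The density `2 e(X) / |X| ^ 2` of a vertex set `X` in `G`. -/
def densIn {V : Type*} (G : SimpleGraph V) (X : Finset V) : ℝ :=
  (interPairs G X X : ℝ) / ((X.card : ℝ) ^ 2)

/-- A two-coloring of the edges of `K_n` (given by its red graph `R`, blue being `Rᶜ`) is an
extremal coloring with parameter `lam`. -/
def IsExtremalColoring {n : ℕ} (R : SimpleGraph (Fin n)) (lam : ℝ) : Prop :=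
  ∃ A B : Finset (Fin n), Disjoint A B ∧ A ∪ B = Finset.univ ∧
    (1 / 2 - lam) * n ≤ (A.card : ℝ) ∧ (1 / 2 - lam) * n ≤ (B.card : ℝ) ∧
    ((1 - lam ≤ densIn R A ∧ 1 - lam ≤ densIn R B ∧ 1 - lam ≤ dens Rᶜ A B) ∨
     (1 - lam ≤ densIn Rᶜ A ∧ 1 - lam ≤ densIn Rᶜ B ∧ 1 - lam ≤ dens R A B))

/-- The number of cycles with `k` vertices in `G`, counted as subgraphs. -/
def cycleCount {V : Type*} (G : SimpleGraph V) (k : ℕ) : ℕ :=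
  Nat.card {f : ZMod k → V // Function.Injective f ∧ ∀ i, G.Adj (f i) (f (i + 1))} / (2 * k)

/-- The number of injective maps `ZMod k → V` that trace out a `k`-cycle of `G`. -/
def cycleMapCount {V : Type*} (G : SimpleGraph V) (k : ℕ) : ℕ :=
  Nat.card {f : ZMod k → V // Function.Injective f ∧ ∀ i, G.Adj (f i) (f (i + 1))}

theorem zmod_val_succ (m : ℕ) (i : ZMod (m + 1)) :
    (i.val < m ∧ (i + 1).val = i.val + 1) ∨ (i.val = m ∧ (i + 1).val = 0) := by
  rcases Nat.lt_or_ge i.val m with h | h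
  · refine Or.inl ⟨h, ?_⟩
    rw [ZMod.val_add, ZMod.val_one'' (by omega), Nat.mod_eq_of_lt (by omega)]
  · have h1 : i.val = m := by
      have := ZMod.val_lt i
      omega
    refine Or.inr ⟨h1, ?_⟩
    rw [ZMod.val_add, h1]
    rcases Nat.eq_zero_or_pos m with rfl | hm
    · exact Nat.mod_one _
    · rw [ZMod.val_one'' (by omega), Nat.mod_self]

/-- A family of `N` sets, each of size at least `d + N`, has at least `d ^ N` systems of distinct
representatives. -/
theorem pow_le_card_injective_mem {V : Type*} [Fintype V] (d : ℕ) :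
    ∀ (N : ℕ) (C : Fin N → Finset V), (∀ i, d + N ≤ (C i).card) →
      d ^ N ≤ Nat.card {f : Fin N → V // Function.Injective f ∧ ∀ i, f i ∈ C i}
  | 0, C, _ => by
    have : Nonempty {f : Fin 0 → V // Function.Injective f ∧ ∀ i, f i ∈ C i} :=
      ⟨⟨Fin.elim0, fun i => i.elim0, fun i => i.elim0⟩⟩
    rw [pow_zero]
    exact Nat.card_pos
  | N + 1, C, h => by
    let D (v : V) : Fin N → Finset V := fun i => (C i.succ).erase v
    have hD : ∀ v, d ^ N ≤ Nat.card {f : Fin N → V // Function.Injective f ∧ ∀ i, f i ∈ D v i} := by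
      intro v
      refine pow_le_card_injective_mem d N (D v) fun i => ?_
      have h1 := h i.succ
      have h2 := Finset.pred_card_le_card_erase (s := C i.succ) (a := v)
      change d + N ≤ ((C i.succ).erase v).card
      omega
    let φ : (Σ v : C 0, {f : Fin N → V // Function.Injective f ∧ ∀ i, f i ∈ D v i}) →
        {f : Fin (N + 1) → V // Function.Injective f ∧ ∀ i, f i ∈ C i} := fun q =>
      ⟨Fin.cons (q.1 : V) q.2.1, by
        obtain ⟨⟨v, hv⟩, ⟨f, hf, hfD⟩⟩ := q
        refine ⟨Fin.cons_injective_iff.2 ⟨?_, hf⟩, fun i => ?_⟩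
        · rintro ⟨i, hi⟩
          exact (Finset.mem_erase.1 (hfD i)).1 hi
        · refine Fin.cases ?_ (fun i => ?_) i
          · simpa using hv
          · simpa using (Finset.mem_erase.1 (hfD i)).2⟩
    have hφ : Function.Injective φ := by
      rintro ⟨⟨v, hv⟩, ⟨f, hf⟩⟩ ⟨⟨w, hw⟩, ⟨g, hg⟩⟩ h
      have h1 : (Fin.cons v f : Fin (N + 1) → V) = Fin.cons w g := congrArg Subtype.val h
      obtain ⟨h2, h3⟩ := Fin.cons_inj.1 h1
      subst h2 h3
      rfl
    refine le_trans ?_ (Nat.card_le_card_of_injective φ hφ)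
    rw [Nat.card_sigma]
    calc d ^ (N + 1) = d * d ^ N := by ring
      _ ≤ (C 0).card * d ^ N := Nat.mul_le_mul_right _ (by have := h 0; omega)
      _ = ∑ _v : C 0, d ^ N := by simp
      _ ≤ _ := Finset.sum_le_sum fun v _ => hD v

theorem card_even_zmod (m : ℕ) : Fintype.card {i : ZMod (2 * m + 1) // Even i.val} = m + 1 := by
  rw [← Fintype.card_fin (m + 1)]
  refine (Fintype.card_congr (Equiv.ofBijective
    (fun j : Fin (m + 1) => (⟨((2 * j.val : ℕ) : ZMod (2 * m + 1)), ?_⟩ :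
      {i : ZMod (2 * m + 1) // Even i.val})) ⟨?_, ?_⟩)).symm
  · rw [ZMod.val_natCast_of_lt (by omega)]
    exact even_two_mul _
  · intro i j h
    have h1 := congrArg (fun x => ZMod.val (Subtype.val x)) h
    simp only at h1
    rw [ZMod.val_natCast_of_lt (by omega), ZMod.val_natCast_of_lt (by omega)] at h1
    exact Fin.ext (by omega)
  · rintro ⟨i, hi⟩
    have h1 := ZMod.val_lt i
    obtain ⟨r, hr⟩ := hi
    refine ⟨⟨r, by omega⟩, Subtype.ext ?_⟩
    change ((2 * r : ℕ) : ZMod (2 * m + 1)) = i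
    have h2 : 2 * r = i.val := by omega
    exact (congrArg Nat.cast h2).trans (ZMod.natCast_zmod_val i)

/-- If `X` has at least `2 m + 1` vertices and more than `m` of them are joined to every other
vertex of `X`, then `X` spans at least `m! (m + 1)!` labelled cycles of length `2 m + 1`. -/
theorem factorial_mul_le_cycleMapCount {V : Type*} [Fintype V] (H : SimpleGraph V) (m : ℕ)
    (hm : 1 ≤ m) (A X : Finset V) (hAX : A ⊆ X) (hadj : ∀ u ∈ X, ∀ w ∈ A, u ≠ w → H.Adj u w)
    (hA : m + 1 ≤ A.card) (hX : 2 * m + 1 ≤ X.card) :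
    (m + 1).factorial * m.factorial ≤ cycleMapCount H (2 * m + 1) := by
  obtain ⟨T, hTA, hT⟩ := Finset.exists_subset_card_eq hA
  obtain ⟨S, hTS, hSX, hS⟩ :=
    Finset.exists_subsuperset_card_eq (hTA.trans hAX) (by omega : T.card ≤ 2 * m + 1) hX
  have hev := card_even_zmod m
  have hodd : Fintype.card {i : ZMod (2 * m + 1) // ¬ Even i.val} = m := by
    rw [Fintype.card_subtype_compl, hev, ZMod.card]
    omega
  have hST : (S \ T).card = m := by
    rw [Finset.card_sdiff_of_subset hTS]
    omega
  have e₁ : {i : ZMod (2 * m + 1) // Even i.val} ≃ T :=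
    Fintype.equivOfCardEq (by rw [hev, Fintype.card_coe, hT])
  have e₂ : {i : ZMod (2 * m + 1) // ¬ Even i.val} ≃ (S \ T : Finset V) :=
    Fintype.equivOfCardEq (by rw [hodd, Fintype.card_coe, hST])
  let F (q : ({i : ZMod (2 * m + 1) // Even i.val} ≃ T) ×
      ({i : ZMod (2 * m + 1) // ¬ Even i.val} ≃ (S \ T : Finset V))) (i : ZMod (2 * m + 1)) : V :=
    if h : Even i.val then q.1 ⟨i, h⟩ else q.2 ⟨i, h⟩
  have Fev : ∀ q i (h : Even i.val), F q i = q.1 ⟨i, h⟩ := fun q i h => dif_pos h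
  have Fodd : ∀ q i (h : ¬ Even i.val), F q i = q.2 ⟨i, h⟩ := fun q i h => dif_neg h
  have FT : ∀ q i, Even i.val → F q i ∈ T := fun q i h => Fev q i h ▸ (q.1 ⟨i, h⟩).2
  have FST : ∀ q i, ¬ Even i.val → F q i ∈ S \ T := fun q i h => Fodd q i h ▸ (q.2 ⟨i, h⟩).2
  have FS : ∀ q i, F q i ∈ S := fun q i => by
    by_cases h : Even i.val
    · exact hTS (FT q i h)
    · exact (Finset.mem_sdiff.1 (FST q i h)).1
  have Finj : ∀ q, Function.Injective (F q) := by
    intro q i j hij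
    by_cases hi : Even i.val <;> by_cases hj : Even j.val
    · rw [Fev q i hi, Fev q j hj] at hij
      exact congrArg Subtype.val (q.1.injective (Subtype.ext hij))
    · exact absurd (hij ▸ FT q i hi) (Finset.mem_sdiff.1 (FST q j hj)).2
    · exact absurd (hij ▸ FT q j hj) (Finset.mem_sdiff.1 (FST q i hi)).2
    · rw [Fodd q i hi, Fodd q j hj] at hij
      exact congrArg Subtype.val (q.2.injective (Subtype.ext hij))
  have Fadj : ∀ q i, H.Adj (F q i) (F q (i + 1)) := by
    intro q i
    have hne : F q i ≠ F q (i + 1) := fun h => by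
      have h1 := congrArg ZMod.val (Finj q h)
      rcases zmod_val_succ (2 * m) i with ⟨_, h2⟩ | ⟨_, h2⟩ <;> omega
    by_cases hi : Even i.val
    · exact (hadj _ (hSX (FS q _)) _ (hTA (FT q i hi)) hne.symm).symm
    · refine hadj _ (hSX (FS q _)) _ (hTA (FT q _ ?_)) hne
      rcases zmod_val_succ (2 * m) i with ⟨_, h2⟩ | ⟨h1, _⟩
      · rw [h2]
        exact (Nat.not_even_iff_odd.1 hi).add_one
      · rw [h1] at hi
        exact absurd (even_two_mul m) hi
  have hcard : Nat.card (({i : ZMod (2 * m + 1) // Even i.val} ≃ T) ×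
      ({i : ZMod (2 * m + 1) // ¬ Even i.val} ≃ (S \ T : Finset V))) =
      (m + 1).factorial * m.factorial := by
    rw [Nat.card_prod, Nat.card_eq_fintype_card, Nat.card_eq_fintype_card,
      Fintype.card_equiv e₁, Fintype.card_equiv e₂, hev, hodd]
  rw [← hcard]
  refine Nat.card_le_card_of_injective (fun q => ⟨F q, Finj q, Fadj q⟩) fun q r h => ?_
  have h1 : F q = F r := congrArg Subtype.val h
  refine Prod.ext (Equiv.ext fun ⟨i, hi⟩ => Subtype.ext ?_)
    (Equiv.ext fun ⟨i, hi⟩ => Subtype.ext ?_)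
  · rw [← Fev q i hi, ← Fev r i hi, h1]
  · rw [← Fodd q i hi, ← Fodd r i hi, h1]

/-- The sequence `v, X 0, Y 0, X 1, Y 1, …`. -/
def interleave {V : Type*} (v : V) (X Y : ℕ → V) (j : ℕ) : V :=
  if j = 0 then v else if Odd j then X (j / 2) else Y (j / 2 - 1)

theorem interleave_zero {V : Type*} (v : V) (X Y : ℕ → V) : interleave v X Y 0 = v := if_pos rfl

theorem interleave_odd {V : Type*} (v : V) (X Y : ℕ → V) (i : ℕ) :
    interleave v X Y (2 * i + 1) = X i := by
  have h1 : Odd (2 * i + 1) := odd_two_mul_add_one i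
  have h2 : (2 * i + 1) / 2 = i := by omega
  rw [interleave, if_neg (by omega), if_pos h1, h2]

theorem interleave_even {V : Type*} (v : V) (X Y : ℕ → V) (i : ℕ) :
    interleave v X Y (2 * i + 2) = Y i := by
  have h1 : ¬ Odd (2 * i + 2) := by
    rw [Nat.not_odd_iff_even]
    exact ⟨i + 1, by ring⟩
  have h2 : (2 * i + 2) / 2 - 1 = i := by omega
  rw [interleave, if_neg (by omega), if_neg h1, h2]

theorem eq_zero_or_odd_or_even (j : ℕ) : j = 0 ∨ (∃ i, j = 2 * i + 1) ∨ ∃ i, j = 2 * i + 2 := by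
  rcases Nat.even_or_odd' j with ⟨i, h | h⟩
  · rcases i with _ | i
    · exact Or.inl h
    · exact Or.inr (Or.inr ⟨i, h⟩)
  · exact Or.inr (Or.inl ⟨i, h⟩)

theorem interleave_injective {V : Type*} (p : ℕ) (v : V) (X Y : ℕ → V)
    (hX : ∀ i ≤ p, ∀ j ≤ p, X i = X j → i = j) (hY : ∀ i ≤ p, ∀ j ≤ p, Y i = Y j → i = j)
    (hXY : ∀ i j, X i ≠ Y j) (hvX : ∀ i, v ≠ X i) (hvY : ∀ i, v ≠ Y i) :
    Function.Injective fun i : ZMod (2 * p + 3) => interleave v X Y i.val := by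
  intro i j h
  refine ZMod.val_injective _ ?_
  have hi := ZMod.val_lt i
  have hj := ZMod.val_lt j
  simp only at h
  generalize i.val = i at *
  generalize j.val = j at *
  rcases eq_zero_or_odd_or_even i with rfl | ⟨i, rfl⟩ | ⟨i, rfl⟩ <;>
    rcases eq_zero_or_odd_or_even j with rfl | ⟨j, rfl⟩ | ⟨j, rfl⟩ <;>
    simp only [interleave_zero, interleave_odd, interleave_even] at h
  · rfl
  · exact absurd h (hvX _)
  · exact absurd h (hvY _)
  · exact absurd h.symm (hvX _)
  · rw [hX i (by omega) j (by omega) h]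
  · exact absurd h (hXY _ _)
  · exact absurd h.symm (hvY _)
  · exact absurd h.symm (hXY _ _)
  · rw [hY i (by omega) j (by omega) h]

theorem interleave_adj {V : Type*} (G : SimpleGraph V) (p : ℕ) (v : V) (X Y : ℕ → V)
    (hvX : G.Adj v (X 0)) (hXY : ∀ i ≤ p, G.Adj (X i) (Y i))
    (hYX : ∀ i < p, G.Adj (Y i) (X (i + 1))) (hYv : G.Adj (Y p) v) (i : ZMod (2 * p + 3)) :
    G.Adj (interleave v X Y i.val) (interleave v X Y (i + 1).val) := by
  rcases zmod_val_succ (2 * p + 2) i with ⟨h1, h2⟩ | ⟨h1, h2⟩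
  · rw [h2]
    generalize i.val = i at *
    rcases eq_zero_or_odd_or_even i with rfl | ⟨i, rfl⟩ | ⟨i, rfl⟩
    · rw [interleave_zero, interleave_odd v X Y 0]
      exact hvX
    · rw [interleave_odd, interleave_even]
      exact hXY i (by omega)
    · rw [interleave_even, show 2 * i + 2 + 1 = 2 * (i + 1) + 1 by ring, interleave_odd]
      exact hYX i (by omega)
  · rw [h1, h2, interleave_zero, interleave_even]
    exact hYv

/-- In a graph that is almost complete between disjoint sets `A` and `B`, a vertex with neighbours
on both sides lies on many odd cycles. -/
theorem pow_le_cycleMapCount {V : Type*} [Fintype V] (G : SimpleGraph V) (p d t : ℕ) (hp : 1 ≤ p)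
    (A B : Finset V) (hAB : Disjoint A B)
    (hA : d + p + 2 * t + 2 ≤ A.card) (hB : d + p + 2 * t + 2 ≤ B.card)
    (hAt : ∀ a ∈ A, (B.filter fun b => ¬ G.Adj a b).card ≤ t)
    (hBt : ∀ b ∈ B, (A.filter fun a => ¬ G.Adj b a).card ≤ t)
    (v a b : V) (ha : a ∈ A) (hb : b ∈ B) (hva : G.Adj v a) (hvb : G.Adj v b) :
    d ^ (2 * p) ≤ cycleMapCount G (2 * p + 3) := by
  let C : Finset V := ((A.filter fun u => G.Adj b u).erase a).erase v
  have hC : d + p ≤ C.card := by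
    have h1 := Finset.pred_card_le_card_erase (s := (A.filter fun u => G.Adj b u).erase a) (a := v)
    have h2 := Finset.pred_card_le_card_erase (s := A.filter fun u => G.Adj b u) (a := a)
    have h3 := Finset.card_filter_add_card_filter_not (s := A) (fun u => G.Adj b u)
    have h4 := hBt b hb
    change d + p ≤ (((A.filter fun u => G.Adj b u).erase a).erase v).card
    omega
  let X (x : Fin p → V) : ℕ → V := fun n =>
    if h : 1 ≤ n ∧ n ≤ p then x ⟨n - 1, by omega⟩ else a
  let Y (y : Fin p → V) : ℕ → V := fun n => if h : n < p then y ⟨n, h⟩ else b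
  let D (x : Fin p → V) : Fin p → Finset V := fun i =>
    ((B.filter fun w => G.Adj (X x i) w ∧ G.Adj (X x (i + 1)) w).erase b).erase v
  have X0 : ∀ x, X x 0 = a := fun x => dif_neg (by omega)
  have Xs : ∀ x (i : Fin p), X x (i + 1) = x i := fun x i => dif_pos ⟨by omega, i.2⟩
  have Yp : ∀ y, Y y p = b := fun y => dif_neg (by omega)
  have Ys : ∀ y (i : Fin p), Y y i = y i := fun y i => dif_pos i.2
  have Xcases : ∀ x n, X x n = a ∨ ∃ i, X x n = x i := fun x n => by
    by_cases h : 1 ≤ n ∧ n ≤ p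
    · exact Or.inr ⟨_, dif_pos h⟩
    · exact Or.inl (dif_neg h)
  have Ycases : ∀ y n, Y y n = b ∨ ∃ i, Y y n = y i := fun y n => by
    by_cases h : n < p
    · exact Or.inr ⟨_, dif_pos h⟩
    · exact Or.inl (dif_neg h)
  have memC : ∀ {u}, u ∈ C → u ≠ v ∧ u ≠ a ∧ u ∈ A ∧ G.Adj b u := fun h => by
    simpa [C] using h
  have memD : ∀ {x i u}, u ∈ D x i →
      u ≠ v ∧ u ≠ b ∧ u ∈ B ∧ G.Adj (X x i) u ∧ G.Adj (X x (i + 1)) u := fun h => by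
    simpa [D] using h
  have XA : ∀ x, (∀ i, x i ∈ C) → ∀ n, X x n ∈ A := fun x hx n => by
    rcases Xcases x n with h | ⟨i, h⟩ <;> rw [h]
    · exact ha
    · exact (memC (hx i)).2.2.1
  have hD : ∀ x, (∀ i, x i ∈ C) → ∀ i, d + p ≤ (D x i).card := by
    intro x hx i
    have h1 := Finset.pred_card_le_card_erase
      (s := (B.filter fun w => G.Adj (X x i) w ∧ G.Adj (X x (i + 1)) w).erase b) (a := v)
    have h2 := Finset.pred_card_le_card_erase
      (s := B.filter fun w => G.Adj (X x i) w ∧ G.Adj (X x (i + 1)) w) (a := b)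
    have h3 := Finset.card_filter_add_card_filter_not (s := B)
      (fun w => G.Adj (X x i) w ∧ G.Adj (X x (i + 1)) w)
    have h4 := hAt _ (XA x hx i)
    have h5 := hAt _ (XA x hx (i + 1))
    have h6 : (B.filter fun w => ¬ (G.Adj (X x i) w ∧ G.Adj (X x (i + 1)) w)).card ≤ t + t := by
      simp only [not_and_or, Finset.filter_or]
      exact (Finset.card_union_le _ _).trans (add_le_add h4 h5)
    change d + p ≤ (((B.filter fun w => G.Adj (X x i) w ∧
      G.Adj (X x (i + 1)) w).erase b).erase v).card
    omega
  let φ : (Σ x : {x : Fin p → V // Function.Injective x ∧ ∀ i, x i ∈ C},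
      {y : Fin p → V // Function.Injective y ∧ ∀ i, y i ∈ D x i}) →
      {f : ZMod (2 * p + 3) → V // Function.Injective f ∧ ∀ i, G.Adj (f i) (f (i + 1))} :=
    fun q => ⟨fun i => interleave v (X q.1) (Y q.2) i.val, by
      obtain ⟨⟨x, hx, hxC⟩, ⟨y, hy, hyD⟩⟩ := q
      have YB : ∀ n, Y y n ∈ B := fun n => by
        rcases Ycases y n with h | ⟨i, h⟩ <;> rw [h]
        · exact hb
        · exact (memD (hyD i)).2.2.1
      refine ⟨interleave_injective p v _ _ ?_ ?_ ?_ ?_ ?_, interleave_adj G p v _ _ ?_ ?_ ?_ ?_⟩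
      · intro i hi j hj h
        rcases i with _ | i <;> rcases j with _ | j
        · rfl
        · rw [X0, Xs x ⟨j, hj⟩] at h
          exact absurd h.symm (memC (hxC _)).2.1
        · rw [X0, Xs x ⟨i, hi⟩] at h
          exact absurd h (memC (hxC _)).2.1
        · rw [Xs x ⟨i, hi⟩, Xs x ⟨j, hj⟩] at h
          have := congrArg Fin.val (hx h)
          simp only at this
          rw [this]
      · intro i hi j hj h
        rcases hi.lt_or_eq with hi | rfl <;> rcases hj.lt_or_eq with hj | rfl
        · rw [Ys y ⟨i, hi⟩, Ys y ⟨j, hj⟩] at h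
          exact congrArg Fin.val (hy h)
        · rw [Yp, Ys y ⟨i, hi⟩] at h
          exact absurd h (memD (hyD _)).2.1
        · rw [Yp, Ys y ⟨j, hj⟩] at h
          exact absurd h.symm (memD (hyD _)).2.1
        · rfl
      · exact fun i j h => Finset.disjoint_left.1 hAB (XA x hxC i) (h ▸ YB j)
      · intro n
        rcases Xcases x n with h | ⟨i, h⟩ <;> simp only [h]
        · exact hva.ne
        · exact (memC (hxC i)).1.symm
      · intro n
        rcases Ycases y n with h | ⟨i, h⟩ <;> simp only [h]
        · exact hvb.ne
        · exact (memD (hyD i)).1.symm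
      · simp only [X0]
        exact hva
      · intro i hi
        rcases hi.lt_or_eq with hi | rfl
        · simp only [Ys y ⟨i, hi⟩]
          exact (memD (hyD ⟨i, hi⟩)).2.2.2.1
        · obtain ⟨j, rfl⟩ : ∃ j, i = j + 1 := ⟨i - 1, by omega⟩
          simp only [Yp, Xs x ⟨j, j.lt_succ_self⟩]
          exact (memC (hxC ⟨j, j.lt_succ_self⟩)).2.2.2.symm
      · intro i hi
        simp only [Ys y ⟨i, hi⟩]
        exact (memD (hyD ⟨i, hi⟩)).2.2.2.2.symm
      · simp only [Yp]
        exact hvb.symm⟩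
  have hφ : Function.Injective φ := by
    rintro ⟨⟨x, hx⟩, ⟨y, hy⟩⟩ ⟨⟨x', hx'⟩, ⟨y', hy'⟩⟩ h
    have h1 : ∀ n, n < 2 * p + 3 → interleave v (X x) (Y y) n = interleave v (X x') (Y y') n := by
      intro n hn
      have h2 := congrFun (congrArg Subtype.val h) (n : ZMod (2 * p + 3))
      simpa only [φ, ZMod.val_natCast_of_lt hn] using h2
    have h2 : x = x' := funext fun i => by
      have := h1 (2 * (i + 1) + 1) (by omega)
      rwa [interleave_odd, interleave_odd, Xs, Xs] at this
    have h3 : y = y' := funext fun i => by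
      have := h1 (2 * i + 2) (by omega)
      rwa [interleave_even, interleave_even, Ys, Ys] at this
    subst h2 h3
    rfl
  refine le_trans ?_ (Nat.card_le_card_of_injective φ hφ)
  rw [Nat.card_sigma]
  calc d ^ (2 * p) = d ^ p * d ^ p := by ring
    _ ≤ Nat.card {x : Fin p → V // Function.Injective x ∧ ∀ i, x i ∈ C} * d ^ p :=
      Nat.mul_le_mul_right _ (pow_le_card_injective_mem d p (fun _ => C) fun _ => hC)
    _ = ∑ _x : {x : Fin p → V // Function.Injective x ∧ ∀ i, x i ∈ C}, d ^ p := by simp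
    _ ≤ _ := Finset.sum_le_sum fun x _ => pow_le_card_injective_mem d p (D x) (hD x x.2.2)

/-- If `G` is almost complete between disjoint sets `A` and `B`, then either `G` or its complement
contains many cycles of length `2 p + 3`. -/
theorem pow_le_or_factorial_le {V : Type*} [Fintype V] (G : SimpleGraph V) (p d t : ℕ) (hp : 1 ≤ p)
    (hV : Fintype.card V = 4 * p + 5) (A B : Finset V) (hAB : Disjoint A B)
    (hA : d + p + 2 * t + 2 ≤ A.card) (hB : d + p + 2 * t + 2 ≤ B.card)
    (hAt : ∀ a ∈ A, (B.filter fun b => ¬ G.Adj a b).card ≤ t)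
    (hBt : ∀ b ∈ B, (A.filter fun a => ¬ G.Adj b a).card ≤ t) :
    d ^ (2 * p) ≤ cycleMapCount G (2 * p + 3) ∨
      (p + 2).factorial * (p + 1).factorial ≤ cycleMapCount Gᶜ (2 * p + 3) := by
  by_cases hv : ∃ v, (∃ a ∈ A, G.Adj v a) ∧ ∃ b ∈ B, G.Adj v b
  · obtain ⟨v, ⟨a, ha, hva⟩, b, hb, hvb⟩ := hv
    exact Or.inl (pow_le_cycleMapCount G p d t hp A B hAB hA hB hAt hBt v a b ha hb hva hvb)
  push Not at hv
  refine Or.inr ?_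
  let N (S : Finset V) : Finset V := Finset.univ.filter fun u => ∀ s ∈ S, ¬ G.Adj u s
  have key : ∀ S T : Finset V, d + p + 2 * t + 2 ≤ S.card → d + p + 2 * t + 2 ≤ T.card →
      (∀ a ∈ S, (T.filter fun b => ¬ G.Adj a b).card ≤ t) →
      (∀ v, (∀ s ∈ S, ¬ G.Adj v s) ∨ ∀ b ∈ T, ¬ G.Adj v b) → 2 * p + 3 ≤ (N S).card →
      (p + 2).factorial * (p + 1).factorial ≤ cycleMapCount Gᶜ (2 * p + 3) := by
    intro S T hS hT hSt hST hN
    refine factorial_mul_le_cycleMapCount Gᶜ (p + 1) (by omega) S (N S) ?_ ?_ (by omega) hN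
    · intro s hs
      rcases hST s with h | h
      · simpa [N] using h
      · have h1 := hSt s hs
        rw [Finset.filter_true_of_mem h] at h1
        omega
    · intro u hu w hw huw
      rw [SimpleGraph.compl_adj]
      exact ⟨huw, (Finset.mem_filter.1 hu).2 w hw⟩
  have hv' : ∀ v, (∀ s ∈ A, ¬ G.Adj v s) ∨ ∀ b ∈ B, ¬ G.Adj v b := fun v => by
    by_cases h : ∃ a ∈ A, G.Adj v a
    · obtain ⟨a, ha, h⟩ := h
      exact Or.inr (hv v ⟨a, ha, h⟩)
    · push Not at h
      exact Or.inl h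
  have hcov : N A ∪ N B = Finset.univ := by
    ext v
    simpa [N] using hv' v
  have hcard := Finset.card_union_le (N A) (N B)
  rw [hcov, Finset.card_univ, hV] at hcard
  rcases Nat.lt_or_ge (N A).card (2 * p + 3) with h | h
  · exact key B A hB hA hBt (fun v => (hv' v).symm) (by omega)
  · exact key A B hA hB hAt hv' h

theorem interPairs_comm {V : Type*} (G : SimpleGraph V) (X Y : Finset V) :
    interPairs G X Y = interPairs G Y X := by
  refine Finset.card_bij (fun q _ => q.swap) ?_ ?_ ?_
  · rintro ⟨x, y⟩ h
    simp only [Finset.mem_filter, Finset.mem_product, Prod.swap] at h ⊢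
    exact ⟨h.1.symm, h.2.symm⟩
  · intro q _ r _ h
    exact Prod.swap_injective h
  · rintro ⟨x, y⟩ h
    simp only [Finset.mem_filter, Finset.mem_product] at h
    refine ⟨(y, x), ?_, rfl⟩
    simp only [Finset.mem_filter, Finset.mem_product]
    exact ⟨h.1.symm, h.2.symm⟩

theorem dens_comm {V : Type*} (G : SimpleGraph V) (X Y : Finset V) : dens G X Y = dens G Y X := by
  rw [_root_.dens, _root_.dens, interPairs_comm, mul_comm]

theorem interPairs_add_sum {V : Type*} (G : SimpleGraph V) (X Y : Finset V) :
    interPairs G X Y + ∑ x ∈ X, (Y.filter fun y => ¬ G.Adj x y).card = X.card * Y.card := by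
  have h : interPairs G X Y = ∑ x ∈ X, (Y.filter fun y => G.Adj x y).card := by
    simp only [interPairs, Finset.card_filter, Finset.sum_product]
  rw [h, ← Finset.sum_add_distrib]
  simp only [Finset.card_filter_add_card_filter_not, Finset.sum_const, smul_eq_mul]

/-- In a dense pair `(X, Y)` few vertices of `X` have more than `t` non-neighbours in `Y`. -/
theorem card_filter_mul_le {V : Type*} (G : SimpleGraph V) (X Y : Finset V) (t : ℕ) (lam : ℝ)
    (hX : 0 < X.card) (hY : 0 < Y.card) (h : 1 - lam ≤ dens G X Y) :
    ((X.filter fun x => ¬ (Y.filter fun y => ¬ G.Adj x y).card ≤ t).card : ℝ) * (t + 1) ≤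
      lam * (X.card * Y.card) := by
  have h1 : (X.filter fun x => ¬ (Y.filter fun y => ¬ G.Adj x y).card ≤ t).card * (t + 1) ≤
      ∑ x ∈ X, (Y.filter fun y => ¬ G.Adj x y).card := by
    calc _ = ∑ _x ∈ X.filter fun x => ¬ (Y.filter fun y => ¬ G.Adj x y).card ≤ t, (t + 1) := by
          simp
      _ ≤ ∑ x ∈ X.filter fun x => ¬ (Y.filter fun y => ¬ G.Adj x y).card ≤ t,
          (Y.filter fun y => ¬ G.Adj x y).card :=
        Finset.sum_le_sum fun x hx => by
          have := (Finset.mem_filter.1 hx).2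
          omega
      _ ≤ _ := Finset.sum_le_sum_of_subset (Finset.filter_subset _ _)
  have h2 := interPairs_add_sum G X Y
  have hpos : (0 : ℝ) < X.card * Y.card := by positivity
  rw [_root_.dens, le_div_iff₀ hpos] at h
  have h3 : ((X.filter fun x => ¬ (Y.filter fun y => ¬ G.Adj x y).card ≤ t).card * (t + 1) : ℝ) ≤
      ((∑ x ∈ X, (Y.filter fun y => ¬ G.Adj x y).card : ℕ) : ℝ) := by exact_mod_cast h1
  have h4 : (interPairs G X Y : ℝ) + ((∑ x ∈ X, (Y.filter fun y => ¬ G.Adj x y).card : ℕ) : ℝ) =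
      X.card * Y.card := by exact_mod_cast h2
  linarith

theorem pow_self_le_factorial_mul (m : ℕ) :
    ((2 * m + 1 : ℕ) : ℝ) ^ (2 * m + 1) ≤
      9 ^ (2 * m + 1) * (((m + 1).factorial * m.factorial : ℕ) : ℝ) := by
  set K : ℝ := ((2 * m + 1 : ℕ) : ℝ) with hK
  have h0 : 0 ≤ K := Nat.cast_nonneg _
  have h1 : ∀ j : ℕ, K ^ j ≤ Real.exp K * j.factorial := fun j =>
    (div_le_iff₀ (by positivity)).1 (Real.pow_div_factorial_le_exp K h0 j)
  have h2 : Real.exp K ≤ 3 ^ (2 * m + 1) := by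
    rw [hK, ← Real.exp_one_pow]
    exact pow_le_pow_left₀ (Real.exp_pos 1).le Real.exp_one_lt_three.le _
  calc K ^ (2 * m + 1) = K ^ (m + 1) * K ^ m := by ring
    _ ≤ (Real.exp K * (m + 1).factorial) * (Real.exp K * m.factorial) := by
      gcongr
      · exact h1 _
      · exact h1 _
    _ ≤ (3 ^ (2 * m + 1) * (m + 1).factorial) * (3 ^ (2 * m + 1) * m.factorial) := by gcongr
    _ = 9 ^ (2 * m + 1) * (((m + 1).factorial * m.factorial : ℕ) : ℝ) := by
      push_cast
      rw [show (9 : ℝ) = 3 * 3 by norm_num, mul_pow]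
      ring

theorem pow_le_div_of_pow_le_mul (k M : ℕ) (hk : 1000 ≤ k)
    (h : (k : ℝ) ^ k ≤ 9 ^ k * k ^ 3 * M) : (1 / 1000 * (k : ℝ)) ^ k ≤ ((M / (2 * k) : ℕ) : ℝ) := by
  by_contra! hlt
  set y : ℝ := (1 / 1000 * (k : ℝ)) ^ k with hy
  have hk' : (1000 : ℝ) ≤ k := by exact_mod_cast hk
  have hy1 : 1 ≤ y := one_le_pow₀ (by linarith)
  have hM : M < 2 * k * (M / (2 * k) + 1) := Nat.lt_mul_div_succ M (by omega)
  have hM' : (M : ℝ) < 2 * k * ((M / (2 * k) : ℕ) + 1) := by exact_mod_cast hM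
  have hM2 : (M : ℝ) ≤ 4 * k * y := by nlinarith
  have hky : (k : ℝ) ^ k = 1000 ^ k * y := by
    rw [hy, ← mul_pow]
    congr 1
    ring
  have h2k : (k : ℝ) ≤ 2 ^ k := by exact_mod_cast Nat.lt_two_pow_self.le
  have h4 : (4 : ℝ) ≤ 2 ^ k := by linarith
  have h5 : (1000 : ℝ) ^ k * y ≤ 288 ^ k * y := by
    calc (1000 : ℝ) ^ k * y ≤ 9 ^ k * k ^ 3 * M := hky ▸ h
      _ ≤ 9 ^ k * k ^ 3 * (4 * k * y) := by gcongr
      _ = 9 ^ k * (4 * k ^ 4) * y := by ring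
      _ ≤ 9 ^ k * (2 ^ k * (2 ^ k) ^ 4) * y := by gcongr
      _ = 288 ^ k * y := by
        rw [show (288 : ℝ) = 9 * (2 * 2 ^ 4) by norm_num, mul_pow, mul_pow, ← pow_mul, ← pow_mul,
          mul_comm 4 k]
  have h6 : (288 : ℝ) ^ k < 1000 ^ k := pow_lt_pow_left₀ (by norm_num) (by norm_num) (by omega)
  nlinarith

/-- Two large sets with almost all pairs between them in `G` force many cycles of odd length `k`
in `G` or in its complement. -/
theorem pow_le_cycleCount_add {k : ℕ} (hodd : Odd k) (hk : 1000 ≤ k)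
    (G : SimpleGraph (Fin (2 * k - 1))) (A B : Finset (Fin (2 * k - 1))) (hAB : Disjoint A B)
    (hU : A ∪ B = Finset.univ) {lam : ℝ} (hlam : lam ≤ 1 / 20000)
    (hA : (1 / 2 - lam) * (2 * k - 1 : ℕ) ≤ (A.card : ℝ))
    (hB : (1 / 2 - lam) * (2 * k - 1 : ℕ) ≤ (B.card : ℝ)) (hd : 1 - lam ≤ dens G A B) :
    (1 / 1000 * (k : ℝ)) ^ k ≤ ((cycleCount G k + cycleCount Gᶜ k : ℕ) : ℝ) := by
  have hk' : (1000 : ℝ) ≤ k := by exact_mod_cast hk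
  have hn : ((2 * k - 1 : ℕ) : ℝ) = 2 * k - 1 := by
    rw [Nat.cast_sub (by omega)]
    push_cast
    ring
  have hsum : (A.card : ℝ) + B.card = 2 * k - 1 := by
    rw [← hn, ← Nat.cast_add, ← Finset.card_union_of_disjoint hAB, hU, Finset.card_univ,
      Fintype.card_fin]
  rw [hn] at hA hB
  have hA1 : 0.99 * k ≤ (A.card : ℝ) := by nlinarith
  have hB1 : 0.99 * k ≤ (B.card : ℝ) := by nlinarith
  set t := k / 100 with ht
  set d := k / 4 with hdef
  have ht1 : (k : ℝ) ≤ 100 * (t + 1) := by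
    have : k ≤ 100 * (t + 1) := by omega
    exact_mod_cast this
  obtain ⟨p, rfl⟩ : ∃ p, k = 2 * p + 3 := by
    obtain ⟨r, hr⟩ := hodd
    exact ⟨r - 1, by omega⟩
  have large : ∀ X Y : Finset (Fin (2 * (2 * p + 3) - 1)),
      0.99 * ((2 * p + 3 : ℕ) : ℝ) ≤ X.card → 0.99 * ((2 * p + 3 : ℕ) : ℝ) ≤ Y.card →
      (X.card : ℝ) + Y.card = 2 * ((2 * p + 3 : ℕ) : ℝ) - 1 → 1 - lam ≤ dens G X Y →
      d + p + 2 * t + 2 ≤ (X.filter fun x => (Y.filter fun y => ¬ G.Adj x y).card ≤ t).card := by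
    intro X Y hX hY hXY hden
    have h1 := card_filter_mul_le G X Y t lam (Nat.cast_pos.1 (by linarith : (0 : ℝ) < X.card))
      (Nat.cast_pos.1 (by linarith : (0 : ℝ) < Y.card)) hden
    have h2 := Finset.card_filter_add_card_filter_not (s := X)
      (fun x => (Y.filter fun y => ¬ G.Adj x y).card ≤ t)
    set b := (X.filter fun x => ¬ (Y.filter fun y => ¬ G.Adj x y).card ≤ t).card
    set g := (X.filter fun x => (Y.filter fun y => ¬ G.Adj x y).card ≤ t).card
    have h2' : (g : ℝ) + b = X.card := by exact_mod_cast h2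
    have hd4 : 4 * (d : ℝ) ≤ ((2 * p + 3 : ℕ) : ℝ) := by
      have : 4 * d ≤ 2 * p + 3 := by omega
      exact_mod_cast this
    have ht4 : 100 * (t : ℝ) ≤ ((2 * p + 3 : ℕ) : ℝ) := by
      have : 100 * t ≤ 2 * p + 3 := by omega
      exact_mod_cast this
    have hp4 : 2 * (p : ℝ) ≤ ((2 * p + 3 : ℕ) : ℝ) := by
      have : 2 * p ≤ 2 * p + 3 := by omega
      exact_mod_cast this
    generalize ((2 * p + 3 : ℕ) : ℝ) = K at *
    have h3 : (b : ℝ) * (K / 100) ≤ 1 / 20000 * ((1.01 * K) * (1.01 * K)) :=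
      calc (b : ℝ) * (K / 100) ≤ b * (t + 1) := by
            gcongr
            linarith
        _ ≤ lam * (X.card * Y.card) := h1
        _ ≤ 1 / 20000 * ((1.01 * K) * (1.01 * K)) := by
            gcongr <;> linarith
    have h4 : (b : ℝ) ≤ 0.01 * K := by
      have hK : 0 < K := by linarith
      by_contra! hb
      have h6 : 0.01 * K * (K / 100) < b * (K / 100) :=
        mul_lt_mul_of_pos_right hb (by positivity)
      have h7 : 0 < K * K := mul_pos hK hK
      linarith
    have h5 : ((d + p + 2 * t + 2 : ℕ) : ℝ) ≤ g := by
      push_cast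
      linarith
    exact_mod_cast h5
  have hA2 := large A B hA1 hB1 hsum hd
  have hB2 := large B A hB1 hA1 (by linarith) (by rwa [dens_comm])
  have key := pow_le_or_factorial_le G p d t (by omega) (by rw [Fintype.card_fin]; omega)
    (A.filter fun x => (B.filter fun y => ¬ G.Adj x y).card ≤ t)
    (B.filter fun x => (A.filter fun y => ¬ G.Adj x y).card ≤ t)
    (Finset.disjoint_filter_filter hAB) (by omega) (by omega)
    (fun a ha => (Finset.card_le_card (Finset.filter_subset_filter _
      (Finset.filter_subset _ _))).trans (Finset.mem_filter.1 ha).2)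
    (fun b hb => (Finset.card_le_card (Finset.filter_subset_filter _
      (Finset.filter_subset _ _))).trans (Finset.mem_filter.1 hb).2)
  push_cast
  have hpos : ∀ H : SimpleGraph (Fin (2 * (2 * p + 3) - 1)),
      (0 : ℝ) ≤ (cycleCount H (2 * p + 3) : ℝ) := fun H => Nat.cast_nonneg _
  rcases key with h | h
  · refine le_add_of_le_of_nonneg ?_ (hpos _)
    have h1 := pow_le_div_of_pow_le_mul (2 * p + 3) (cycleMapCount G (2 * p + 3)) hk ?_
    · exact_mod_cast h1
    have h2 : ((2 * p + 3 : ℕ) : ℝ) ≤ 8 * d := by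
      have : 2 * p + 3 ≤ 8 * d := by omega
      exact_mod_cast this
    have h3 : ((d : ℝ)) ^ (2 * p) ≤ cycleMapCount G (2 * p + 3) := by exact_mod_cast h
    generalize ((2 * p + 3 : ℕ) : ℝ) = K at *
    have hK : 0 ≤ K := by linarith
    calc K ^ (2 * p + 3) = K ^ (2 * p) * K ^ 3 := by ring
      _ ≤ (8 * d) ^ (2 * p) * K ^ 3 := by gcongr
      _ = 8 ^ (2 * p) * K ^ 3 * d ^ (2 * p) := by rw [mul_pow]; ring
      _ ≤ 9 ^ (2 * p + 3) * K ^ 3 * cycleMapCount G (2 * p + 3) := by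
        gcongr
        exact (pow_le_pow_left₀ (by norm_num) (by norm_num) _).trans
          (pow_le_pow_right₀ (by norm_num : (1 : ℝ) ≤ 9) (by omega))
  · refine le_add_of_nonneg_of_le (hpos _) ?_
    have h1 := pow_le_div_of_pow_le_mul (2 * p + 3) (cycleMapCount Gᶜ (2 * p + 3)) hk ?_
    · exact_mod_cast h1
    have h2 := pow_self_le_factorial_mul (p + 1)
    rw [show 2 * (p + 1) + 1 = 2 * p + 3 by ring] at h2
    have h3 : (((p + 2).factorial * (p + 1).factorial : ℕ) : ℝ) ≤
      cycleMapCount Gᶜ (2 * p + 3) := by exact_mod_cast h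
    generalize ((2 * p + 3 : ℕ) : ℝ) = K at *
    refine h2.trans ?_
    have h4 : (1 : ℝ) ≤ K ^ 3 := one_le_pow₀ (by linarith)
    calc _ ≤ 9 ^ (2 * p + 3) * (cycleMapCount Gᶜ (2 * p + 3) : ℝ) := by gcongr
      _ ≤ 9 ^ (2 * p + 3) * K ^ 3 * cycleMapCount Gᶜ (2 * p + 3) := by
        gcongr
        exact le_mul_of_one_le_right (by positivity) h4

theorem sqrt_sqrt_parameter_le :
    300 * Real.sqrt (20 * Real.sqrt ((10 : ℝ) ^ (-30 : ℤ))) ≤ 1 / 20000 := by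
  have h1 : Real.sqrt ((10 : ℝ) ^ (-30 : ℤ)) ≤ 1 / 10 ^ 15 :=
    Real.sqrt_le_iff.2 ⟨by norm_num, by norm_num⟩
  have h2 : Real.sqrt (20 * Real.sqrt ((10 : ℝ) ^ (-30 : ℤ))) ≤ 15 / 10 ^ 8 :=
    Real.sqrt_le_iff.2 ⟨by norm_num, (mul_le_mul_of_nonneg_left h1 (by norm_num)).trans
      (by norm_num)⟩
  linarith

/-- With `ε = 10 ^ (-30)`, `α = 20 √ε` and `λ = 300 √α`: extremal colorings of `K_{2k-1}`
with parameter `λ` contain at least `(c k) ^ k` monochromatic cycles of length `k`. -/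
theorem stmt_15 :
    ∃ c : ℝ, 0 < c ∧ ∃ k₀ : ℕ, ∀ k : ℕ, Odd k → k₀ ≤ k →
      ∀ R : SimpleGraph (Fin (2 * k - 1)),
        IsExtremalColoring R (300 * Real.sqrt (20 * Real.sqrt ((10 : ℝ) ^ (-30 : ℤ)))) →
        (c * k) ^ k ≤ ((cycleCount R k + cycleCount Rᶜ k : ℕ) : ℝ) := by
  refine ⟨1 / 1000, by norm_num, 1000, fun k hodd hk R hR => ?_⟩
  obtain ⟨A, B, hAB, hU, hA, hB, ⟨-, -, hd⟩ | ⟨-, -, hd⟩⟩ := hR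
  · have h := pow_le_cycleCount_add hodd hk Rᶜ A B hAB hU sqrt_sqrt_parameter_le hA hB hd
    rwa [compl_compl, add_comm] at h
  · exact pow_le_cycleCount_add hodd hk R A B hAB hU sqrt_sqrt_parameter_le hA hB hd
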